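/- Embed each w_j ∈ ℂ⁴ into ℂ⁵ as w̃_j = (w_j, 0). Then there exist ten product vectors in ℂ³ ⊗ ℂ⁵ which together with the five vectors v_j ⊗ w̃_j, j = 0,…,4, form an orthonormal basis of ℂ³ ⊗ ℂ⁵ consisting entirely of product vectors; that is, the set {v_j ⊗ w_j} becomes completable after locally extending the second party's space from ℂ⁴ to ℂ⁵. -/

import Mathlib

/-!
STATEMENT 15. Embedding each w_j ∈ ℂ⁴ into ℂ⁵ as w̃_j = (w_j, 0), there exist ten product
vectors in ℂ³ ⊗ ℂ⁵ which together with the five vectors v_j ⊗ w̃_j form an orthonormal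
basis of ℂ³ ⊗ ℂ⁵ consisting entirely of product vectors: the set {v_j ⊗ w_j} becomes
completable after locally extending the second party's space from ℂ⁴ to ℂ⁵.
-/

open ComplexConjugate

noncomputable section

/-- The standard hermitian inner product on `ι → ℂ` (antilinear in the first slot). -/
def ip {ι : Type*} [Fintype ι] (x y : ι → ℂ) : ℂ := ∑ i, conj (x i) * y i

/-- Bipartite product (Kronecker) vector `a ⊗ b`. -/
def pv2 {ι κ : Type*} (a : ι → ℂ) (b : κ → ℂ) : ι × κ → ℂ := fun p => a p.1 * b p.2

/-- Height of the pentagonal pyramid: `h = (1/2)√(1+√5)`. -/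
def pyrH : ℝ := (1 / 2) * Real.sqrt (1 + Real.sqrt 5)

/-- Normalization `N = 2/√(5+√5)`. -/
def pyrN : ℝ := 2 / Real.sqrt (5 + Real.sqrt 5)

/-- The Pyramid vectors `v_j = N (cos(2πj/5), sin(2πj/5), h) ∈ ℝ³ ⊂ ℂ³`. -/
def pyrV (j : Fin 5) : Fin 3 → ℂ :=
  ![((pyrN * Real.cos (2 * Real.pi * (j : ℕ) / 5) : ℝ) : ℂ),
    ((pyrN * Real.sin (2 * Real.pi * (j : ℕ) / 5) : ℝ) : ℂ),
    ((pyrN * pyrH : ℝ) : ℂ)]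

/-- Normalization `N' = √(2/√5)`. -/
def wN : ℝ := Real.sqrt (2 / Real.sqrt 5)

/-- The vectors `w_j ∈ ℝ⁴ ⊂ ℂ⁴`. -/
def wV (j : Fin 5) : Fin 4 → ℂ :=
  ![((wN * (Real.sqrt (Real.cos (Real.pi / 5)) * Real.cos (2 * (j : ℕ) * Real.pi / 5)) : ℝ) : ℂ),
    ((wN * (Real.sqrt (Real.cos (Real.pi / 5)) * Real.sin (2 * (j : ℕ) * Real.pi / 5)) : ℝ) : ℂ),
    ((wN * (Real.sqrt (Real.cos (2 * Real.pi / 5)) * Real.cos (4 * (j : ℕ) * Real.pi / 5)) : ℝ) : ℂ),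
    ((wN * (Real.sqrt (Real.cos (2 * Real.pi / 5)) * Real.sin (4 * (j : ℕ) * Real.pi / 5)) : ℝ) : ℂ)]

/-- The embedding of `w_j` into ℂ⁵: `w̃_j = (w_j, 0)`. -/
def wTilde (j : Fin 5) : Fin 5 → ℂ :=
  fun i => if h : (i : ℕ) < 4 then wV j ⟨(i : ℕ), h⟩ else 0

section InnerProduct

variable {ι κ : Type*} [Fintype ι] [Fintype κ]

lemma ip_conj_symm (x y : ι → ℂ) : conj (ip x y) = ip y x := by
  simp [ip, mul_comm]

lemma ip_add_left (x y z : ι → ℂ) : ip (x + y) z = ip x z + ip y z := by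
  simp [ip, add_mul, Finset.sum_add_distrib]

lemma ip_add_right (x y z : ι → ℂ) : ip x (y + z) = ip x y + ip x z := by
  simp [ip, mul_add, Finset.sum_add_distrib]

lemma ip_smul_left (c : ℝ) (x y : ι → ℂ) : ip (c • x) y = c * ip x y := by
  simp [ip, Finset.mul_sum, mul_assoc]

lemma ip_smul_right (c : ℝ) (x y : ι → ℂ) : ip x (c • y) = c * ip x y := by
  simp [ip, Finset.mul_sum, mul_left_comm]

lemma ip_zero_right (x : ι → ℂ) : ip x 0 = 0 := by
  simp [ip]

lemma ip_pv2 (a c : ι → ℂ) (b d : κ → ℂ) :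
    ip (pv2 a b) (pv2 c d) = ip a c * ip b d := by
  simp only [ip, pv2, Fintype.sum_prod_type, Finset.sum_mul_sum, map_mul]
  exact Finset.sum_congr rfl fun _ _ => Finset.sum_congr rfl fun _ _ => by ring

lemma linearIndependent_of_ip_eq_ite {n : ℕ} (f : Fin n → ι → ℂ)
    (hf : ∀ s t, ip (f s) (f t) = if s = t then 1 else 0) : LinearIndependent ℂ f := by
  rw [Fintype.linearIndependent_iff]
  intro g hg s
  have key : ip (f s) (∑ t, g t • f t) = ∑ t, g t * ip (f s) (f t) := by
    simp only [ip, Finset.sum_apply, Pi.smul_apply, smul_eq_mul, Finset.mul_sum]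
    rw [Finset.sum_comm]
    exact Finset.sum_congr rfl fun _ _ => Finset.sum_congr rfl fun _ _ => by ring
  rw [hg, ip_zero_right] at key
  simpa [hf] using key.symm

end InnerProduct

section Trigonometry

lemma cos_two_pi_div_five : Real.cos (2 * Real.pi / 5) = (Real.sqrt 5 - 1) / 4 := by
  have h5 : Real.sqrt 5 ^ 2 = 5 := Real.sq_sqrt (by norm_num)
  rw [mul_div_assoc, Real.cos_two_mul, Real.cos_pi_div_five]
  nlinarith

lemma cos_pentagon_sub (i j : Fin 5) :
    Real.cos (2 * Real.pi * (i : ℕ) / 5 - 2 * Real.pi * (j : ℕ) / 5) =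
      if i = j then 1 else if i = j + 1 ∨ j = i + 1 then (Real.sqrt 5 - 1) / 4
      else -(1 + Real.sqrt 5) / 4 := by
  have h1 : Real.cos (2 * Real.pi * 1 / 5) = (Real.sqrt 5 - 1) / 4 := by
    rw [mul_one, cos_two_pi_div_five]
  have h2 : Real.cos (2 * Real.pi * 2 / 5) = -(1 + Real.sqrt 5) / 4 := by
    rw [show 2 * Real.pi * 2 / 5 = Real.pi - Real.pi / 5 by ring, Real.cos_pi_sub,
      Real.cos_pi_div_five, neg_div]
  have h3 : Real.cos (2 * Real.pi * 3 / 5) = -(1 + Real.sqrt 5) / 4 := by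
    rw [show 2 * Real.pi * 3 / 5 = Real.pi / 5 + Real.pi by ring, Real.cos_add_pi,
      Real.cos_pi_div_five, neg_div]
  have h4 : Real.cos (2 * Real.pi * 4 / 5) = (Real.sqrt 5 - 1) / 4 := by
    rw [show 2 * Real.pi * 4 / 5 = 2 * Real.pi - 2 * Real.pi / 5 by ring,
      Real.cos_two_pi_sub, cos_two_pi_div_five]
  have hd : 2 * Real.pi * (i : ℕ) / 5 - 2 * Real.pi * (j : ℕ) / 5 =
      2 * Real.pi * ((i : ℕ) - (j : ℕ) : ℝ) / 5 := by ring
  have hneg (x : ℝ) : Real.cos (2 * Real.pi * -x / 5) = Real.cos (2 * Real.pi * x / 5) := by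
    rw [← Real.cos_neg]; ring_nf
  rw [hd]
  split_ifs with h h'
  · simp [h]
  · have hz : ∀ i j : Fin 5, i = j + 1 ∨ j = i + 1 →
        (i : ℤ) - (j : ℤ) = 1 ∨ (i : ℤ) - (j : ℤ) = -1 ∨
        (i : ℤ) - (j : ℤ) = 4 ∨ (i : ℤ) - (j : ℤ) = -4 := by decide
    have hr : ((i : ℕ) - (j : ℕ) : ℝ) = 1 ∨ ((i : ℕ) - (j : ℕ) : ℝ) = -1 ∨
        ((i : ℕ) - (j : ℕ) : ℝ) = 4 ∨ ((i : ℕ) - (j : ℕ) : ℝ) = -4 := by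
      exact_mod_cast hz i j h'
    rcases hr with hr | hr | hr | hr <;> simp only [hr, hneg, h1, h4]
  · have hz : ∀ i j : Fin 5, i ≠ j → ¬(i = j + 1 ∨ j = i + 1) →
        (i : ℤ) - (j : ℤ) = 2 ∨ (i : ℤ) - (j : ℤ) = -2 ∨
        (i : ℤ) - (j : ℤ) = 3 ∨ (i : ℤ) - (j : ℤ) = -3 := by decide
    have hr : ((i : ℕ) - (j : ℕ) : ℝ) = 2 ∨ ((i : ℕ) - (j : ℕ) : ℝ) = -2 ∨
        ((i : ℕ) - (j : ℕ) : ℝ) = 3 ∨ ((i : ℕ) - (j : ℕ) : ℝ) = -3 := by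
      exact_mod_cast hz i j h h'
    rcases hr with hr | hr | hr | hr <;> simp only [hr, hneg, h2, h3]

end Trigonometry

section Gram

/-- The inverse golden ratio, the overlap of adjacent Pyramid vectors. -/
def pyrC : ℝ := (Real.sqrt 5 - 1) / 2

lemma pyrC_sq : pyrC ^ 2 = 1 - pyrC := by
  have h5 : Real.sqrt 5 ^ 2 = 5 := Real.sq_sqrt (by norm_num)
  unfold pyrC
  nlinarith

lemma pyrC_pos : 0 < pyrC := by
  have : (1 : ℝ) < Real.sqrt 5 := by
    rw [Real.lt_sqrt] <;> norm_num
  unfold pyrC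
  linarith

lemma ip_pyrV (i j : Fin 5) :
    ip (pyrV i) (pyrV j) =
      if i = j then 1 else if i = j + 1 ∨ j = i + 1 then (pyrC : ℂ) else 0 := by
  have h5 : Real.sqrt 5 ^ 2 = 5 := Real.sq_sqrt (by norm_num)
  have hpos : 0 ≤ Real.sqrt 5 := Real.sqrt_nonneg 5
  have hN : pyrN ^ 2 = 4 / (5 + Real.sqrt 5) := by
    rw [pyrN, div_pow, Real.sq_sqrt (by positivity)]; norm_num
  have hh : pyrH ^ 2 = (1 + Real.sqrt 5) / 4 := by
    rw [pyrH, mul_pow, Real.sq_sqrt (by positivity)]; ring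
  have key : ip (pyrV i) (pyrV j) =
      ((pyrN ^ 2 * (Real.cos (2 * Real.pi * (i : ℕ) / 5 - 2 * Real.pi * (j : ℕ) / 5)
        + pyrH ^ 2) : ℝ) : ℂ) := by
    rw [Real.cos_sub]
    simp only [ip, pyrV, Fin.sum_univ_three, Matrix.cons_val_zero, Matrix.cons_val_one,
      Matrix.cons_val, Complex.conj_ofReal]
    push_cast
    ring
  rw [key, cos_pentagon_sub, hN, hh]
  have hne : 5 + Real.sqrt 5 ≠ 0 := by positivity
  split_ifs
  · rw [← Complex.ofReal_one]
    congr 1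
    field_simp
    ring
  · congr 1
    unfold pyrC
    field_simp
    nlinarith
  · rw [← Complex.ofReal_zero]
    congr 1
    ring

lemma ip_wTilde (i j : Fin 5) :
    ip (wTilde i) (wTilde j) =
      if i = j then 1 else if i = j + 1 ∨ j = i + 1 then 0 else -(1 / 2) := by
  have h5 : Real.sqrt 5 ^ 2 = 5 := Real.sq_sqrt (by norm_num)
  have hpos : 0 < Real.sqrt 5 := by positivity
  have hN : wN ^ 2 = 2 / Real.sqrt 5 := Real.sq_sqrt (by positivity)
  have hs1 : Real.sqrt (Real.cos (Real.pi / 5)) ^ 2 = (1 + Real.sqrt 5) / 4 := by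
    rw [Real.cos_pi_div_five, Real.sq_sqrt (by positivity)]
  have hs2 : Real.sqrt (Real.cos (2 * Real.pi / 5)) ^ 2 = (Real.sqrt 5 - 1) / 4 := by
    have := pyrC_pos
    unfold pyrC at this
    rw [cos_two_pi_div_five, Real.sq_sqrt (by linarith)]
  have key : ip (wTilde i) (wTilde j) =
      ((wN ^ 2 * (Real.sqrt (Real.cos (Real.pi / 5)) ^ 2 *
          Real.cos (2 * Real.pi * (i : ℕ) / 5 - 2 * Real.pi * (j : ℕ) / 5)
        + Real.sqrt (Real.cos (2 * Real.pi / 5)) ^ 2 *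
          Real.cos (2 * (2 * Real.pi * (i : ℕ) / 5 - 2 * Real.pi * (j : ℕ) / 5))) : ℝ) : ℂ) := by
    rw [show 2 * (2 * Real.pi * (i : ℕ) / 5 - 2 * Real.pi * (j : ℕ) / 5) =
        4 * (i : ℕ) * Real.pi / 5 - 4 * (j : ℕ) * Real.pi / 5 by ring,
      show 2 * Real.pi * (i : ℕ) / 5 - 2 * Real.pi * (j : ℕ) / 5 =
        2 * (i : ℕ) * Real.pi / 5 - 2 * (j : ℕ) * Real.pi / 5 by ring,
      Real.cos_sub, Real.cos_sub]
    simp only [ip, Fin.sum_univ_five]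
    simp [wTilde, wV, -Complex.ofReal_cos, -Complex.ofReal_sin]
    ring
  rw [key, Real.cos_two_mul, cos_pentagon_sub, hN, hs1, hs2]
  split_ifs
  · rw [← Complex.ofReal_one]
    congr 1
    field_simp
    ring
  · rw [← Complex.ofReal_zero]
    congr 1
    field_simp
    nlinarith
  · rw [show (-(1 / 2) : ℂ) = ((-(1 / 2) : ℝ) : ℂ) by push_cast; ring]
    congr 1
    field_simp
    nlinarith

/-- The unit vector of `ℂ⁵` orthogonal to the embedded `ℂ⁴`. -/
def extE : Fin 5 → ℂ := ![0, 0, 0, 0, 1]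

lemma ip_extE : ip extE extE = 1 := by
  simp [ip, extE, Fin.sum_univ_five]

lemma ip_extE_wTilde (j : Fin 5) : ip extE (wTilde j) = 0 := by
  simp [ip, extE, wTilde, Fin.sum_univ_five]

lemma ip_wTilde_extE (j : Fin 5) : ip (wTilde j) extE = 0 := by
  rw [← ip_conj_symm, ip_extE_wTilde, map_zero]

/-- The orthonormal basis of `ℂ⁵` for which `w̃_j = (u_j - u_{j-2}) / √2`. -/
def extU (j : Fin 5) : Fin 5 → ℂ :=
  (1 / Real.sqrt 5) • extE + (Real.sqrt 2 / 5) •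
    ((4 : ℝ) • wTilde j + (3 : ℝ) • wTilde (j + 3) + (2 : ℝ) • wTilde (j + 1) + wTilde (j + 4))

/-- The vectors `(u_j + u_{j-2}) / √2`, partners of the `w̃_j`. -/
def extZ (j : Fin 5) : Fin 5 → ℂ :=
  (Real.sqrt 2 / 2) • (extU j + extU (j + 3))

/-- The unit vectors of `ℂ³` orthogonal to `v_j` and `v_{j+2}`. -/
def pyrA (j : Fin 5) : Fin 3 → ℂ :=
  (1 / Real.sqrt pyrC) • (pyrV (j + 3) + (-pyrC) • pyrV (j + 2))

lemma ofReal_sqrt_two_sq : (Real.sqrt 2 : ℂ) ^ 2 = 2 := by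
  rw [← Complex.ofReal_pow, Real.sq_sqrt (by norm_num)]; norm_num

lemma ofReal_sqrt_five_sq : (Real.sqrt 5 : ℂ) ^ 2 = 5 := by
  rw [← Complex.ofReal_pow, Real.sq_sqrt (by norm_num)]; norm_num

lemma ip_extU_wTilde (i j : Fin 5) :
    ip (extU i) (wTilde j) =
      if i = j then (Real.sqrt 2 / 2 : ℂ) else if j = i + 2 then -(Real.sqrt 2 / 2 : ℂ) else 0 := by
  simp only [extU, ip_add_left, ip_smul_left, ip_extE_wTilde, ip_wTilde]
  fin_cases i <;> fin_cases j <;> simp [Fin.ext_iff] <;> ring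

lemma ip_extU_extE (i : Fin 5) : ip (extU i) extE = 1 / (Real.sqrt 5 : ℂ) := by
  simp [extU, ip_add_left, ip_smul_left, ip_extE, ip_wTilde_extE]

lemma ip_extU (i j : Fin 5) : ip (extU i) (extU j) = if i = j then 1 else 0 := by
  have h2 := ofReal_sqrt_two_sq
  have h5 : (1 / (Real.sqrt 5 : ℂ)) * (1 / (Real.sqrt 5 : ℂ)) = 1 / 5 := by
    rw [← sq, div_pow, ofReal_sqrt_five_sq, one_pow]
  rw [extU.eq_def j]
  simp only [ip_add_right, ip_smul_right, ip_extU_extE, ip_extU_wTilde, Complex.ofReal_div,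
    Complex.ofReal_one, h5, Complex.ofReal_ofNat]
  fin_cases i <;> fin_cases j <;> simp [Fin.ext_iff] <;>
    first
    | linear_combination (2 / 5 : ℂ) * h2
    | linear_combination (-(1 / 10) : ℂ) * h2

lemma ip_extU_extZ (i j : Fin 5) :
    ip (extU i) (extZ j) = if i = j ∨ i = j + 3 then (Real.sqrt 2 / 2 : ℂ) else 0 := by
  simp only [extZ, ip_add_right, ip_smul_right, ip_extU]
  fin_cases i <;> fin_cases j <;> simp [Fin.ext_iff]

lemma ip_extZ (i j : Fin 5) :
    ip (extZ i) (extZ j) =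
      if i = j then 1 else if i = j + 1 ∨ j = i + 1 then 0 else 1 / 2 := by
  have h2 := ofReal_sqrt_two_sq
  rw [extZ.eq_def i]
  simp only [ip_add_left, ip_smul_left, ip_extU_extZ]
  fin_cases i <;> fin_cases j <;> simp [Fin.ext_iff] <;> grind

lemma ip_extZ_wTilde (i j : Fin 5) (h : i = j ∨ i = j + 1 ∨ j = i + 1) :
    ip (extZ i) (wTilde j) = 0 := by
  simp only [extZ, ip_add_left, ip_smul_left, ip_extU_wTilde]
  fin_cases i <;> fin_cases j <;> simp [Fin.ext_iff] at h ⊢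

lemma ip_pyrA_pyrV (i j : Fin 5) (h : j = i ∨ j = i + 2) : ip (pyrA i) (pyrV j) = 0 := by
  simp only [pyrA, ip_add_left, ip_smul_left, ip_pyrV]
  fin_cases i <;> fin_cases j <;> simp [Fin.ext_iff] at h ⊢

lemma ip_pyrA (i : Fin 5) : ip (pyrA i) (pyrA i) = 1 := by
  have hs : (Real.sqrt pyrC : ℂ) ^ 2 = pyrC := by
    rw [← Complex.ofReal_pow, Real.sq_sqrt pyrC_pos.le]
  have hc : (pyrC : ℂ) ^ 2 = 1 - pyrC := by exact_mod_cast pyrC_sq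
  have h0 : (Real.sqrt pyrC : ℂ) ≠ 0 := by
    exact_mod_cast (Real.sqrt_pos.2 pyrC_pos).ne'
  have hadj : i + 3 = i + 2 + 1 := by rw [add_assoc]; rfl
  have hne : i + 3 ≠ i + 2 := by simp
  simp only [pyrA, ip_add_left, ip_smul_left, ip_add_right, ip_smul_right, ip_pyrV, hadj]
  simp
  field_simp
  grind

end Gram

section Blocks

lemma ip_pyrV_wTilde_block (i j : Fin 5) :
    ip (pv2 (pyrV i) (wTilde i)) (pv2 (pyrV j) (wTilde j)) = if i = j then 1 else 0 := by
  rw [ip_pv2, ip_pyrV, ip_wTilde]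
  split_ifs <;> simp

lemma ip_pyrA_extU_block (i j : Fin 5) :
    ip (pv2 (pyrA i) (extU i)) (pv2 (pyrA j) (extU j)) = if i = j then 1 else 0 := by
  rw [ip_pv2, ip_extU]
  split_ifs with h
  · rw [h, ip_pyrA, one_mul]
  · rw [mul_zero]

lemma ip_pyrV_extZ_block (i j : Fin 5) :
    ip (pv2 (pyrV i) (extZ i)) (pv2 (pyrV j) (extZ j)) = if i = j then 1 else 0 := by
  rw [ip_pv2, ip_pyrV, ip_extZ]
  split_ifs <;> simp

lemma ip_pyrA_extU_pyrV_wTilde (i j : Fin 5) :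
    ip (pv2 (pyrA i) (extU i)) (pv2 (pyrV j) (wTilde j)) = 0 := by
  rw [ip_pv2, ip_extU_wTilde]
  split_ifs with h h'
  · rw [ip_pyrA_pyrV i j (Or.inl h.symm), zero_mul]
  · rw [ip_pyrA_pyrV i j (Or.inr h'), zero_mul]
  · rw [mul_zero]

lemma ip_pyrA_extU_pyrV_extZ (i j : Fin 5) :
    ip (pv2 (pyrA i) (extU i)) (pv2 (pyrV j) (extZ j)) = 0 := by
  rw [ip_pv2, ip_extU_extZ]
  split_ifs with h
  · rw [ip_pyrA_pyrV i j (by revert i j; decide), zero_mul]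
  · rw [mul_zero]

lemma ip_pyrV_extZ_pyrV_wTilde (i j : Fin 5) :
    ip (pv2 (pyrV i) (extZ i)) (pv2 (pyrV j) (wTilde j)) = 0 := by
  rw [ip_pv2, ip_pyrV]
  split_ifs with h h'
  · rw [ip_extZ_wTilde i j (Or.inl h), mul_zero]
  · rw [ip_extZ_wTilde i j (Or.inr h'), mul_zero]
  · rw [zero_mul]

lemma ip_eq_zero_symm {ι : Type*} [Fintype ι] {x y : ι → ℂ} (h : ip x y = 0) : ip y x = 0 := by
  rw [← ip_conj_symm, h, map_zero]

lemma ip_append {ι : Type*} [Fintype ι] {m n : ℕ} (f : Fin m → ι → ℂ) (g : Fin n → ι → ℂ)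
    (hf : ∀ i j, ip (f i) (f j) = if i = j then 1 else 0)
    (hg : ∀ i j, ip (g i) (g j) = if i = j then 1 else 0)
    (hgf : ∀ i j, ip (g i) (f j) = 0) (s t : Fin (m + n)) :
    ip (Fin.append f g s) (Fin.append f g t) = if s = t then 1 else 0 := by
  induction s using Fin.addCases with
  | left i =>
    induction t using Fin.addCases with
    | left j => simp [hf]
    | right j =>
      have : Fin.castAdd n i ≠ Fin.natAdd m j := by
        simp only [ne_eq, Fin.ext_iff, Fin.val_castAdd, Fin.val_natAdd]; omega
      simp [ip_eq_zero_symm (hgf j i), this]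
  | right i =>
    induction t using Fin.addCases with
    | left j =>
      have : Fin.natAdd m i ≠ Fin.castAdd n j := by
        simp only [ne_eq, Fin.ext_iff, Fin.val_castAdd, Fin.val_natAdd]; omega
      simp [hgf, this]
    | right j => simp [hg]

lemma ne_zero_of_ip_self_eq_one {ι : Type*} [Fintype ι] {x : ι → ℂ} (h : ip x x = 1) : x ≠ 0 := by
  rintro rfl
  rw [ip_zero_right] at h
  exact zero_ne_one h

end Blocks

/-- **The set `{v_j ⊗ w_j}` is completable after locally extending ℂ⁴ to ℂ⁵:** there are
ten product vectors `x_t ⊗ y_t` in ℂ³ ⊗ ℂ⁵ such that together with the five vectors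
`v_j ⊗ w̃_j` they form an orthonormal basis of ℂ³ ⊗ ℂ⁵ consisting of product vectors. -/
theorem vw_completable_in_extension :
    ∃ (x : Fin 10 → Fin 3 → ℂ) (y : Fin 10 → Fin 5 → ℂ),
      (∀ t, x t ≠ 0) ∧ (∀ t, y t ≠ 0) ∧
      (∀ s t : Fin 15,
        ip ((Fin.append (fun j : Fin 5 => pv2 (pyrV j) (wTilde j))
              (fun t : Fin 10 => pv2 (x t) (y t))) s)
           ((Fin.append (fun j : Fin 5 => pv2 (pyrV j) (wTilde j))
              (fun t : Fin 10 => pv2 (x t) (y t))) t)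
          = if s = t then 1 else 0) ∧
      Submodule.span ℂ
          (Set.range (Fin.append (fun j : Fin 5 => pv2 (pyrV j) (wTilde j))
            (fun t : Fin 10 => pv2 (x t) (y t))))
        = ⊤ := by
  have hpv : (fun t : Fin (5 + 5) => pv2 (Fin.append pyrA pyrV t) (Fin.append extU extZ t)) =
      (Fin.append (fun j => pv2 (pyrA j) (extU j)) (fun j => pv2 (pyrV j) (extZ j)) :
        Fin (5 + 5) → Fin 3 × Fin 5 → ℂ) := by
    funext t
    induction t using Fin.addCases (m := 5) (n := 5) with
    | left i => simp only [Fin.append_left]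
    | right i => simp only [Fin.append_right]
  have hcompl := ip_append _ _ ip_pyrA_extU_block ip_pyrV_extZ_block
    fun i j => ip_eq_zero_symm (ip_pyrA_extU_pyrV_extZ j i)
  rw [← hpv] at hcompl
  have horth := ip_append (fun j : Fin 5 => pv2 (pyrV j) (wTilde j))
    (fun t : Fin (5 + 5) => pv2 (Fin.append pyrA pyrV t) (Fin.append extU extZ t))
    ip_pyrV_wTilde_block
    hcompl
    (by
      intro i j
      induction i using Fin.addCases with
      | left i => simpa only [Fin.append_left] using ip_pyrA_extU_pyrV_wTilde i j
      | right i => simpa only [Fin.append_right] using ip_pyrV_extZ_pyrV_wTilde i j)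
  refine ⟨Fin.append pyrA pyrV, Fin.append extU extZ, ?_, ?_, horth, ?_⟩
  · intro t
    induction t using Fin.addCases (m := 5) (n := 5) with
    | left i =>
      rw [Fin.append_left]
      exact ne_zero_of_ip_self_eq_one (ip_pyrA i)
    | right i =>
      rw [Fin.append_right]
      exact ne_zero_of_ip_self_eq_one (by simp [ip_pyrV])
  · intro t
    induction t using Fin.addCases (m := 5) (n := 5) with
    | left i =>
      rw [Fin.append_left]
      exact ne_zero_of_ip_self_eq_one (by simp [ip_extU])
    | right i =>
      rw [Fin.append_right]
      exact ne_zero_of_ip_self_eq_one (by simp [ip_extZ])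
  · exact (linearIndependent_of_ip_eq_ite _ horth).span_eq_top_of_card_eq_finrank' (by simp)

end
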